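/- For every n ≥ 1 there exist nested monomial ideals I₃ ⊆ I₂ ⊆ I₁ of R = ℂ[x,y] with dim_ℂ(R/I₁) = n, dim_ℂ(R/I₂) = n+1, dim_ℂ(R/I₃) = n+2 such that dim_ℂ T(I₁,I₂,I₃) = 2n+5. (Since the flag Hilbert scheme Hilb^{n,n+1,n+2}(ℂ²) has dimension 2n+4 and T(I₁,I₂,I₃) is its Zariski tangent space at (I₁,I₂,I₃), this shows Hilb^{n,n+1,n+2}(ℂ²) is singular for every n ≥ 1.) -/

import Mathlib

/-!
Statement 3: for every n ≥ 1 there are nested monomial ideals I₃ ⊆ I₂ ⊆ I₁ of ℂ[x,y] of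
colengths n, n+1, n+2 whose flag tangent space has dimension 2n+5; hence
Hilb^{n,n+1,n+2}(ℂ²) (which has dimension 2n+4) is singular for every n ≥ 1.
-/

set_option synthInstance.maxHeartbeats 1000000
set_option maxHeartbeats 1000000

noncomputable section

open MvPolynomial

/-- `R = ℂ[x,y]`. -/
abbrev Rxy : Type := MvPolynomial (Fin 2) ℂ

/-- An ideal of `ℂ[x,y]` is a monomial ideal if it is generated by monomials. -/
def IsMonomialIdeal (I : Ideal Rxy) : Prop :=
  ∃ S : Set (ℕ × ℕ), I = Ideal.span ((fun p : ℕ × ℕ => X 0 ^ p.1 * X 1 ^ p.2) '' S)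

/-- The canonical surjection `R⧸I → R⧸J` for nested ideals `I ≤ J`, as an `R`-linear map. -/
def quotFactor {I J : Ideal Rxy} (h : I ≤ J) : (Rxy ⧸ I) →ₗ[Rxy] Rxy ⧸ J :=
  Submodule.mapQ I J LinearMap.id h

/-- The Zariski tangent space `T(I₁,I₂,I₃)` of the three-step flag Hilbert scheme at a flag
`I₃ ≤ I₂ ≤ I₁`: the space of triples
`(f,h,g) ∈ Hom_R(I₁,R/I₁) × Hom_R(I₂,R/I₂) × Hom_R(I₃,R/I₃)` with
`f(a) = π₂₁(h(a))` for all `a ∈ I₂` and `h(b) = π₃₂(g(b))` for all `b ∈ I₃`. -/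
def flagTangent3 (I₁ I₂ I₃ : Ideal Rxy) (h21 : I₂ ≤ I₁) (h32 : I₃ ≤ I₂) :
    Submodule Rxy
      ((I₁ →ₗ[Rxy] Rxy ⧸ I₁) × (I₂ →ₗ[Rxy] Rxy ⧸ I₂) × (I₃ →ₗ[Rxy] Rxy ⧸ I₃)) :=
  LinearMap.ker
      (((LinearMap.lcomp Rxy (Rxy ⧸ I₁) (Submodule.inclusion h21)).comp
          (LinearMap.fst Rxy (I₁ →ₗ[Rxy] Rxy ⧸ I₁)
            ((I₂ →ₗ[Rxy] Rxy ⧸ I₂) × (I₃ →ₗ[Rxy] Rxy ⧸ I₃))))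
        - ((LinearMap.llcomp Rxy I₂ (Rxy ⧸ I₂) (Rxy ⧸ I₁) (quotFactor h21)).comp
          ((LinearMap.fst Rxy (I₂ →ₗ[Rxy] Rxy ⧸ I₂) (I₃ →ₗ[Rxy] Rxy ⧸ I₃)).comp
            (LinearMap.snd Rxy (I₁ →ₗ[Rxy] Rxy ⧸ I₁)
              ((I₂ →ₗ[Rxy] Rxy ⧸ I₂) × (I₃ →ₗ[Rxy] Rxy ⧸ I₃))))))
    ⊓ LinearMap.ker
      (((LinearMap.lcomp Rxy (Rxy ⧸ I₂) (Submodule.inclusion h32)).comp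
          ((LinearMap.fst Rxy (I₂ →ₗ[Rxy] Rxy ⧸ I₂) (I₃ →ₗ[Rxy] Rxy ⧸ I₃)).comp
            (LinearMap.snd Rxy (I₁ →ₗ[Rxy] Rxy ⧸ I₁)
              ((I₂ →ₗ[Rxy] Rxy ⧸ I₂) × (I₃ →ₗ[Rxy] Rxy ⧸ I₃)))))
        - ((LinearMap.llcomp Rxy I₃ (Rxy ⧸ I₃) (Rxy ⧸ I₂) (quotFactor h32)).comp
          ((LinearMap.snd Rxy (I₂ →ₗ[Rxy] Rxy ⧸ I₂) (I₃ →ₗ[Rxy] Rxy ⧸ I₃)).comp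
            (LinearMap.snd Rxy (I₁ →ₗ[Rxy] Rxy ⧸ I₁)
              ((I₂ →ₗ[Rxy] Rxy ⧸ I₂) × (I₃ →ₗ[Rxy] Rxy ⧸ I₃))))))

/-- The ideal `(x^k, y)`. -/
def idA (k : ℕ) : Ideal Rxy := Ideal.span {X 0 ^ k, X 1}

/-- The ideal `(x^k, xy, y^2)`. -/
def idB (k : ℕ) : Ideal Rxy := Ideal.span {X 0 ^ k, X 0 * X 1, X 1 ^ 2}

lemma monom_eq (p : ℕ × ℕ) : (X 0 ^ p.1 * X 1 ^ p.2 : Rxy) =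
    monomial (Finsupp.single 0 p.1 + Finsupp.single 1 p.2) 1 := by
  rw [X_pow_eq_monomial, X_pow_eq_monomial, monomial_mul, one_mul]

lemma idA_eq (k : ℕ) : idA k =
    Ideal.span ((fun p : ℕ × ℕ => (X 0 ^ p.1 * X 1 ^ p.2 : Rxy)) '' {(k, 0), (0, 1)}) := by
  simp [idA, Set.image_pair]

lemma idB_eq (k : ℕ) : idB k =
    Ideal.span ((fun p : ℕ × ℕ => (X 0 ^ p.1 * X 1 ^ p.2 : Rxy)) ''
      {(k, 0), (1, 1), (0, 2)}) := by
  simp [idB, Set.image_insert_eq]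

lemma mem_span_iff (S : Set (ℕ × ℕ)) (p : Rxy) :
    p ∈ Ideal.span ((fun p : ℕ × ℕ => (X 0 ^ p.1 * X 1 ^ p.2 : Rxy)) '' S) ↔
      ∀ e : Fin 2 →₀ ℕ, coeff e p ≠ 0 → ∃ s ∈ S, s.1 ≤ e 0 ∧ s.2 ≤ e 1 := by
  have h : ((fun p : ℕ × ℕ => (X 0 ^ p.1 * X 1 ^ p.2 : Rxy)) '' S) =
      (fun s => monomial s (1 : ℂ)) ''
        ((fun p : ℕ × ℕ => (Finsupp.single 0 p.1 + Finsupp.single 1 p.2 : Fin 2 →₀ ℕ)) '' S) := by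
    rw [Set.image_image]
    exact Set.image_congr fun p _ => monom_eq p
  rw [h, mem_ideal_span_monomial_image]
  simp only [mem_support_iff, Set.exists_mem_image]
  refine forall_congr' fun e => imp_congr_right fun _ => exists_congr fun s => and_congr_right fun _ => ?_
  rw [Finsupp.le_def, Fin.forall_fin_two]
  simp

lemma fin2_ext {e e_a : Fin 2 →₀ ℕ} (h0 : e 0 = e_a 0) (h1 : e 1 = e_a 1) : e = e_a := by
  ext i; fin_cases i
  · exact h0
  · exact h1

lemma mem_idA (k : ℕ) (p : Rxy) :
    p ∈ idA k ↔ ∀ i < k, coeff (Finsupp.single 0 i) p = 0 := by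
  rw [idA_eq, mem_span_iff]
  constructor
  · intro h i hi
    by_contra hc
    obtain ⟨s, hs, h1, h2⟩ := h _ hc
    simp at hs
    rcases hs with rfl | rfl <;> simp at h1 h2
    omega
  · intro h e he
    by_cases h1 : e 1 = 0
    · refine ⟨(k, 0), by simp, ?_, by simp⟩
      by_contra hlt
      apply he
      have : e = Finsupp.single 0 (e 0) := fin2_ext (by simp) (by simp [h1])
      rw [this]
      exact h _ (by simpa using hlt)
    · exact ⟨(0, 1), by simp, by simp, by simp; omega⟩

lemma mem_idB (k : ℕ) (hk : 1 ≤ k) (p : Rxy) :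
    p ∈ idB k ↔ p ∈ idA k ∧ coeff (Finsupp.single 1 1) p = 0 := by
  rw [mem_idA, idB_eq, mem_span_iff]
  constructor
  · intro h
    constructor
    · intro i hi
      by_contra hc
      obtain ⟨s, hs, h1, h2⟩ := h _ hc
      simp at hs
      rcases hs with rfl | rfl | rfl <;> simp at h1 h2
      omega
    · by_contra hc
      obtain ⟨s, hs, h1, h2⟩ := h _ hc
      simp at hs
      rcases hs with rfl | rfl | rfl <;> simp at h1 h2
      omega
  · rintro ⟨h, h_a⟩ e he
    by_cases h1 : e 1 = 0
    · refine ⟨(k, 0), by simp, ?_, by simp⟩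
      by_contra hlt
      apply he
      have : e = Finsupp.single 0 (e 0) := fin2_ext (by simp) (by simp [h1])
      rw [this]
      exact h _ (by simpa using hlt)
    · by_cases h0 : e 0 = 0
      · refine ⟨(0, 2), by simp, by simp, ?_⟩
        by_contra hlt
        apply he
        have : e = Finsupp.single 1 1 := fin2_ext (by simp [h0]) (by simp at hlt ⊢; omega)
        rw [this]
        exact h_a
      · exact ⟨(1, 1), by simp, by simp; omega, by simp; omega⟩

/-- Quotients by ideals that are kernels of surjective `ℂ`-linear maps. -/
lemma exists_quot_equiv {V : Type*} [AddCommGroup V] [Module ℂ V] (I : Ideal Rxy)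
    (φ : Rxy →ₗ[ℂ] V) (hφ : Function.Surjective φ) (h : ∀ p, p ∈ I ↔ φ p = 0) :
    Nonempty ((Rxy ⧸ I) ≃ₗ[ℂ] V) := by
  have hk : I.restrictScalars ℂ = LinearMap.ker φ := by
    ext p; simp [h p]
  exact ⟨(Submodule.Quotient.restrictScalarsEquiv ℂ I).symm.trans
    ((Submodule.quotEquivOfEq _ _ hk).trans (φ.quotKerEquivOfSurjective hφ))⟩

lemma exists_functional (I : Ideal Rxy) (φ : Rxy →ₗ[ℂ] ℂ) (h : ∀ p ∈ I, φ p = 0) :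
    ∃ ψ : (Rxy ⧸ I) →ₗ[ℂ] ℂ, ∀ p, ψ (Submodule.Quotient.mk p) = φ p := by
  refine ⟨((I.restrictScalars ℂ).liftQ φ ?_).comp
    (Submodule.Quotient.restrictScalarsEquiv ℂ I).symm.toLinearMap, fun p => ?_⟩
  · intro p hp
    exact h p hp
  · rfl

lemma single_zero_ne (i : ℕ) : (Finsupp.single 0 i : Fin 2 →₀ ℕ) ≠ Finsupp.single 1 1 := by
  intro h
  have := DFunLike.congr_fun h 1
  simp at this

/-- The coefficients of `1, x, …, x^(k-1)`. -/
def evA (k : ℕ) : Rxy →ₗ[ℂ] (Fin k → ℂ) :=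
  LinearMap.pi fun i => lcoeff ℂ (Finsupp.single 0 (i : ℕ))

lemma evA_apply (k : ℕ) (p : Rxy) (i : Fin k) :
    evA k p i = coeff (Finsupp.single 0 (i : ℕ)) p := rfl

lemma evA_sum (k : ℕ) (v : Fin k → ℂ) :
    evA k (∑ i : Fin k, monomial (Finsupp.single 0 (i : ℕ)) (v i)) = v := by
  ext j
  rw [evA_apply, coeff_sum, Finset.sum_eq_single j]
  · simp
  · intro b _ hb
    rw [coeff_monomial, if_neg]
    intro h
    apply hb
    have := DFunLike.congr_fun h 0
    simp at this
    exact Fin.ext this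
  · simp

lemma rank_idA (k : ℕ) : Module.rank ℂ (Rxy ⧸ idA k) = (k : Cardinal) := by
  obtain ⟨e⟩ := exists_quot_equiv (idA k) (evA k) (fun v => ⟨_, evA_sum k v⟩) (by
    intro p
    rw [mem_idA]
    constructor
    · intro h; ext i; exact h i i.2
    · intro h i hi; exact congrFun h ⟨i, hi⟩)
  rw [e.rank_eq]
  simp

lemma rank_idB (k : ℕ) (hk : 1 ≤ k) :
    Module.rank ℂ (Rxy ⧸ idB k) = ((k + 1 : ℕ) : Cardinal) := by
  obtain ⟨e⟩ := exists_quot_equiv (idB k)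
    ((evA k).prod (lcoeff ℂ (Finsupp.single 1 1))) (by
      rintro ⟨v, c⟩
      refine ⟨(∑ i : Fin k, monomial (Finsupp.single 0 (i : ℕ)) (v i)) +
        monomial (Finsupp.single 1 1) c, ?_⟩
      refine Prod.ext ?_ ?_
      · have : evA k (monomial (Finsupp.single 1 1) c) = 0 := by
          ext i
          rw [evA_apply, coeff_monomial, if_neg (single_zero_ne _).symm]
          rfl
        rw [LinearMap.prod_apply, Function.prod, map_add, this, add_zero, evA_sum]
      · simp [lcoeff_apply, coeff_sum, coeff_monomial, single_zero_ne]) (by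
    intro p
    rw [mem_idB k hk, mem_idA]
    simp only [LinearMap.prod_apply, Function.prod, Prod.mk_eq_zero, lcoeff_apply]
    refine and_congr_left fun _ => ?_
    constructor
    · intro h; ext i; exact h i i.2
    · intro h i hi; exact congrFun h ⟨i, hi⟩)
  rw [e.rank_eq]
  simp

lemma exists_lift {M N P : Type*} [AddCommGroup M] [AddCommGroup N] [AddCommGroup P]
    [Module Rxy M] [Module Rxy N] [Module Rxy P] (u : M →ₗ[Rxy] N) (w : M →ₗ[Rxy] P)
    (h : ∀ m, u m = 0 → w m = 0) (I : Submodule Rxy N) (hI : I = LinearMap.range u) :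
    ∃ f : I →ₗ[Rxy] P, ∀ m (hm : u m ∈ I), f ⟨u m, hm⟩ = w m := by
  subst hI
  refine ⟨((LinearMap.ker u).liftQ w (fun m hm => h m hm)).comp
    u.quotKerEquivRange.symm.toLinearMap, fun m hm => ?_⟩
  simp only [LinearMap.comp_apply, LinearEquiv.coe_coe]
  rw [LinearMap.quotKerEquivRange_symm_apply_image]
  rfl

lemma X1_dvd (r : Rxy) (k : ℕ) (h : X 1 ∣ r * X 0 ^ k) : X 1 ∣ r := by
  have hp : Prime (X 1 : Rxy) := X_prime
  rcases hp.dvd_or_dvd h with h | h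
  · exact h
  · have := hp.dvd_of_dvd_pow h
    rw [X_dvd_X] at this
    simp at this

lemma X0_dvd (r : Rxy) (h : X 0 ∣ r * X 1) : X 0 ∣ r := by
  have hp : Prime (X 0 : Rxy) := X_prime
  rcases hp.dvd_or_dvd h with h | h
  · exact h
  · rw [X_dvd_X] at h
    simp at h

lemma xk_memA (k : ℕ) : (X 0 ^ k : Rxy) ∈ idA k := Ideal.subset_span (by simp)
lemma y_memA (k : ℕ) : (X 1 : Rxy) ∈ idA k := Ideal.subset_span (by simp)
lemma xk_memB (k : ℕ) : (X 0 ^ k : Rxy) ∈ idB k := Ideal.subset_span (by simp)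
lemma xy_memB (k : ℕ) : (X 0 * X 1 : Rxy) ∈ idB k := Ideal.subset_span (by simp)
lemma yy_memB (k : ℕ) : (X 1 ^ 2 : Rxy) ∈ idB k := Ideal.subset_span (by simp)

lemma homA_exists {P : Type*} [AddCommGroup P] [Module Rxy P] (k : ℕ) (c d : P)
    (h : (X 1 : Rxy) • c = (X 0 ^ k : Rxy) • d) :
    ∃ f : idA k →ₗ[Rxy] P, f ⟨_, xk_memA k⟩ = c ∧ f ⟨_, y_memA k⟩ = d := by
  let u : Rxy × Rxy →ₗ[Rxy] Rxy :=
    (LinearMap.toSpanSingleton Rxy Rxy (X 0 ^ k)).coprod (LinearMap.toSpanSingleton Rxy Rxy (X 1))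
  let w : Rxy × Rxy →ₗ[Rxy] P :=
    (LinearMap.toSpanSingleton Rxy P c).coprod (LinearMap.toSpanSingleton Rxy P d)
  have hu : ∀ r s, u (r, s) = r * X 0 ^ k + s * X 1 := fun r s => by simp [u]
  have hw : ∀ r s, w (r, s) = r • c + s • d := fun r s => by simp [w]
  obtain ⟨f, hf⟩ := exists_lift u w (by
    rintro ⟨r, s⟩ h0
    rw [hu] at h0
    rw [hw]
    obtain ⟨t, rfl⟩ := X1_dvd r k ⟨-s, by linear_combination h0⟩
    have hs : s = - (t * X 0 ^ k) := by
      have hX : (X 1 : Rxy) ≠ 0 := X_ne_zero 1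
      apply mul_right_cancel₀ hX
      linear_combination h0
    rw [hs, mul_comm, mul_smul, h, neg_smul, mul_smul, add_neg_cancel]) (idA k) (by
    ext p
    rw [idA, Ideal.mem_span_pair]
    constructor
    · rintro ⟨a, b, rfl⟩; exact ⟨(a, b), hu a b⟩
    · rintro ⟨⟨a, b⟩, rfl⟩; exact ⟨a, b, (hu a b).symm⟩)
  refine ⟨f, ?_, ?_⟩
  · have e : u (1, 0) = X 0 ^ k := by rw [hu]; ring
    have := hf (1, 0) (by rw [e]; exact xk_memA k)
    rw [hw] at this
    simpa [e] using this
  · have e : u (0, 1) = X 1 := by rw [hu]; ring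
    have := hf (0, 1) (by rw [e]; exact y_memA k)
    rw [hw] at this
    simpa [e] using this

lemma homB_exists {P : Type*} [AddCommGroup P] [Module Rxy P] (k : ℕ) (p q r : P)
    (h1 : (X 1 : Rxy) • p = (X 0 ^ k : Rxy) • q) (h2 : (X 1 : Rxy) • q = (X 0 : Rxy) • r) :
    ∃ f : idB (k + 1) →ₗ[Rxy] P,
      f ⟨_, xk_memB (k + 1)⟩ = p ∧ f ⟨_, xy_memB (k + 1)⟩ = q ∧ f ⟨_, yy_memB (k + 1)⟩ = r := by
  let u : Rxy × Rxy × Rxy →ₗ[Rxy] Rxy :=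
    (LinearMap.toSpanSingleton Rxy Rxy (X 0 ^ (k + 1))).coprod
      ((LinearMap.toSpanSingleton Rxy Rxy (X 0 * X 1)).coprod
        (LinearMap.toSpanSingleton Rxy Rxy (X 1 ^ 2)))
  let w : Rxy × Rxy × Rxy →ₗ[Rxy] P :=
    (LinearMap.toSpanSingleton Rxy P p).coprod
      ((LinearMap.toSpanSingleton Rxy P q).coprod (LinearMap.toSpanSingleton Rxy P r))
  have hu : ∀ a b c, u (a, b, c) = a * X 0 ^ (k + 1) + (b * (X 0 * X 1) + c * X 1 ^ 2) :=
    fun a b c => by simp [u]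
  have hw : ∀ a b c, w (a, b, c) = a • p + (b • q + c • r) := fun a b c => by simp [w]
  obtain ⟨f, hf⟩ := exists_lift u w (by
    rintro ⟨a, b, c⟩ h0
    rw [hu] at h0
    rw [hw]
    obtain ⟨s, rfl⟩ := X1_dvd a (k + 1) ⟨-(b * X 0 + c * X 1), by linear_combination h0⟩
    have hX : (X 1 : Rxy) ≠ 0 := X_ne_zero 1
    have hX0 : (X 0 : Rxy) ≠ 0 := X_ne_zero 0
    have h3 : s * X 0 ^ (k + 1) + b * X 0 + c * X 1 = 0 := by
      apply mul_right_cancel₀ hX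
      linear_combination h0
    obtain ⟨t, rfl⟩ := X0_dvd c ⟨-(s * X 0 ^ k + b), by linear_combination h3⟩
    have hb : b = - (s * X 0 ^ k) - t * X 1 := by
      apply mul_right_cancel₀ hX0
      linear_combination h3
    rw [hb, mul_comm (X 1) s, mul_comm (X 0) t, mul_smul, h1, mul_smul t, ← h2, sub_smul, neg_smul,
      mul_smul, mul_smul]
    abel) (idB (k + 1)) (by
    ext p
    rw [idB, Ideal.mem_span_insert]
    simp only [Ideal.mem_span_pair]
    constructor
    · rintro ⟨a, z, ⟨b, c, rfl⟩, rfl⟩; exact ⟨(a, b, c), hu a b c⟩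
    · rintro ⟨⟨a, b, c⟩, rfl⟩; exact ⟨a, _, ⟨b, c, rfl⟩, hu a b c⟩)
  refine ⟨f, ?_, ?_, ?_⟩
  · have e : u (1, 0, 0) = X 0 ^ (k + 1) := by rw [hu]; ring
    have := hf (1, 0, 0) (by rw [e]; exact xk_memB _)
    rw [hw] at this
    simpa [e] using this
  · have e : u (0, 1, 0) = X 0 * X 1 := by rw [hu]; ring
    have := hf (0, 1, 0) (by rw [e]; exact xy_memB _)
    rw [hw] at this
    simpa [e] using this
  · have e : u (0, 0, 1) = X 1 ^ 2 := by rw [hu]; ring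
    have := hf (0, 0, 1) (by rw [e]; exact yy_memB _)
    rw [hw] at this
    simpa [e] using this

lemma homA_ext {P : Type*} [AddCommGroup P] [Module Rxy P] {k : ℕ} {f g : idA k →ₗ[Rxy] P}
    (h1 : f ⟨_, xk_memA k⟩ = g ⟨_, xk_memA k⟩) (h2 : f ⟨_, y_memA k⟩ = g ⟨_, y_memA k⟩) :
    f = g := by
  rw [Submodule.linearMap_eq_iff_of_eq_span f g
    (S := {X 0 ^ k, X 1}) (V := idA k) rfl]
  rintro ⟨s, hs⟩
  rcases hs with rfl | rfl
  · exact h1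
  · exact h2

lemma homB_ext {P : Type*} [AddCommGroup P] [Module Rxy P] {k : ℕ} {f g : idB k →ₗ[Rxy] P}
    (h1 : f ⟨_, xk_memB k⟩ = g ⟨_, xk_memB k⟩) (h2 : f ⟨_, xy_memB k⟩ = g ⟨_, xy_memB k⟩)
    (h3 : f ⟨_, yy_memB k⟩ = g ⟨_, yy_memB k⟩) :
    f = g := by
  rw [Submodule.linearMap_eq_iff_of_eq_span f g
    (S := {X 0 ^ k, X 0 * X 1, X 1 ^ 2}) (V := idB k) rfl]
  rintro ⟨s, hs⟩
  rcases hs with rfl | rfl | rfl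
  · exact h1
  · exact h2
  · exact h3

lemma le21 (n : ℕ) : idA (n + 1) ≤ idA n := by
  intro p hp
  rw [mem_idA] at *
  exact fun i hi => hp i (by omega)

lemma le32 (n : ℕ) : idB (n + 1) ≤ idA (n + 1) := fun p hp =>
  ((mem_idB _ (by omega) p).1 hp).1

lemma mem_flag (I₁ I₂ I₃ : Ideal Rxy) (h21 : I₂ ≤ I₁) (h32 : I₃ ≤ I₂) (t) :
    t ∈ flagTangent3 I₁ I₂ I₃ h21 h32 ↔
      t.1.comp (Submodule.inclusion h21) = (quotFactor h21).comp t.2.1 ∧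
      t.2.1.comp (Submodule.inclusion h32) = (quotFactor h32).comp t.2.2 := by
  rw [flagTangent3, Submodule.mem_inf, LinearMap.mem_ker, LinearMap.mem_ker,
    LinearMap.sub_apply, LinearMap.sub_apply, sub_eq_zero, sub_eq_zero]
  exact Iff.rfl

lemma quotFactor_mk {I J : Ideal Rxy} (h : I ≤ J) (p : Rxy) :
    quotFactor h (Submodule.Quotient.mk p) = Submodule.Quotient.mk p := rfl

lemma rank_flag (m : ℕ) :
    Module.rank ℂ ↥(flagTangent3 (idA (m + 1)) (idA (m + 1 + 1)) (idB (m + 1 + 1))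
      (le21 _) (le32 _)) = ((2 * (m + 1) + 5 : ℕ) : Cardinal) := by
  obtain ⟨γ, hγ⟩ := exists_functional (idA (m + 1 + 1)) (lcoeff ℂ (Finsupp.single 0 (m + 1)))
    (fun p hp => (mem_idA _ p).1 hp _ (by omega))
  obtain ⟨β, hβ⟩ := exists_functional (idB (m + 1 + 1)) (lcoeff ℂ (Finsupp.single 1 1))
    (fun p hp => ((mem_idB _ (by omega) p).1 hp).2)
  -- kernels of the projections
  have kγ : ∀ z : Rxy ⧸ idA (m + 1 + 1), quotFactor (le21 (m + 1)) z = 0 → γ z = 0 → z = 0 := by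
    intro z hz h0
    obtain ⟨p, rfl⟩ := Submodule.Quotient.mk_surjective _ z
    rw [quotFactor_mk, Submodule.Quotient.mk_eq_zero, mem_idA] at hz
    rw [hγ] at h0
    rw [Submodule.Quotient.mk_eq_zero, mem_idA]
    intro i hi
    rcases Nat.lt_succ_iff_lt_or_eq.1 hi with h | rfl
    · exact hz i h
    · exact h0
  have kβ : ∀ z : Rxy ⧸ idB (m + 1 + 1), quotFactor (le32 (m + 1)) z = 0 → β z = 0 → z = 0 := by
    intro z hz h0
    obtain ⟨p, rfl⟩ := Submodule.Quotient.mk_surjective _ z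
    rw [quotFactor_mk, Submodule.Quotient.mk_eq_zero] at hz
    rw [hβ] at h0
    rw [Submodule.Quotient.mk_eq_zero, mem_idB _ (by omega)]
    exact ⟨hz, h0⟩
  have kγ_a : ∀ z w : Rxy ⧸ idA (m + 1 + 1),
      quotFactor (le21 (m + 1)) z = quotFactor (le21 (m + 1)) w → γ z = γ w → z = w :=
    fun z w h1 h2 => sub_eq_zero.1 (kγ _ (by rw [map_sub, h1, sub_self])
      (by rw [map_sub, h2, sub_self]))
  have kβ_a : ∀ z w : Rxy ⧸ idB (m + 1 + 1),
      quotFactor (le32 (m + 1)) z = quotFactor (le32 (m + 1)) w → β z = β w → z = w :=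
    fun z w h1 h2 => sub_eq_zero.1 (kβ _ (by rw [map_sub, h1, sub_self])
      (by rw [map_sub, h2, sub_self]))
  let T := flagTangent3 (idA (m + 1)) (idA (m + 1 + 1)) (idB (m + 1 + 1)) (le21 _) (le32 _)
  let Φ : T →ₗ[ℂ] (Rxy ⧸ idA (m + 1)) × (Rxy ⧸ idA (m + 1 + 1)) × ℂ × ℂ × ℂ × ℂ :=
    { toFun := fun t => (t.1.1 ⟨_, xk_memA _⟩, t.1.2.1 ⟨_, y_memA _⟩,
        γ (t.1.2.1 ⟨_, xk_memA _⟩), β (t.1.2.2 ⟨_, xk_memB _⟩),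
        β (t.1.2.2 ⟨_, xy_memB _⟩), β (t.1.2.2 ⟨_, yy_memB _⟩))
      map_add' := fun s t => by simp
      map_smul' := fun c t => by simp }
  have hΦ : Function.Bijective Φ := by
    constructor
    · rintro ⟨⟨f, h, g⟩, ht⟩ ⟨⟨f_a, h_a, g_a⟩, ht_a⟩ h0
      obtain ⟨c1, c2⟩ := (mem_flag _ _ _ _ _ _).1 ht
      obtain ⟨c1_a, c2_a⟩ := (mem_flag _ _ _ _ _ _).1 ht_a
      simp only [Φ, LinearMap.coe_mk, AddHom.coe_mk, Prod.mk.injEq] at h0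
      obtain ⟨e1, e2, e3, e4, e5, e6⟩ := h0
      dsimp only at c1 c2 c1_a c2_a
      have e : Submodule.inclusion (le21 (m + 1)) ⟨_, xk_memA _⟩ =
          (X 0 : Rxy) • (⟨_, xk_memA _⟩ : idA (m + 1)) := by
        ext1
        simp [pow_succ, mul_comm]
      have hh : h = h_a := by
        refine homA_ext (kγ_a _ _ ?_ e3) e2
        have t1 := LinearMap.congr_fun c1 ⟨_, xk_memA _⟩
        have t2 := LinearMap.congr_fun c1_a ⟨_, xk_memA _⟩
        simp only [LinearMap.comp_apply] at t1 t2
        rw [← t1, ← t2, e, map_smul, map_smul, e1]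
      subst hh
      have hf : f = f_a := by
        refine homA_ext e1 ?_
        exact LinearMap.congr_fun (c1.trans c1_a.symm) ⟨_, y_memA _⟩
      have hz : ∀ b, quotFactor (le32 (m + 1)) (g b) = quotFactor (le32 (m + 1)) (g_a b) :=
        fun b => LinearMap.congr_fun (c2.symm.trans c2_a) b
      have hg : g = g_a := homB_ext (kβ_a _ _ (hz _) e4) (kβ_a _ _ (hz _) e5) (kβ_a _ _ (hz _) e6)
      subst hf hg
      rfl
    · rintro ⟨a, d, c, p_a, q_a, r_a⟩
      obtain ⟨a, rfl⟩ := Submodule.Quotient.mk_surjective _ a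
      obtain ⟨d, rfl⟩ := Submodule.Quotient.mk_surjective _ d
      let c0 : ℂ := c - coeff (Finsupp.single 0 (m + 1)) (X 0 * a)
      let cc : Rxy := X 0 * a + monomial (Finsupp.single 0 (m + 1)) c0
      have hcc : cc = X 0 * a + C c0 * X 0 ^ (m + 1) := by
        simp only [cc, X_pow_eq_monomial, C_mul_monomial, mul_one]
      -- adjust the coefficient of `y`
      have adj : ∀ (z : Rxy) (v : ℂ), ∃ s : ℂ,
          coeff (Finsupp.single 1 1) (z + C s * X 1) = v := by
        intro z v
        refine ⟨v - coeff (Finsupp.single 1 1) z, ?_⟩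
        rw [coeff_add, coeff_C_mul, coeff_X, if_pos rfl]
        ring
      obtain ⟨p_b, hp⟩ := adj cc p_a
      obtain ⟨q_b, hq⟩ := adj (X 0 * d) q_a
      obtain ⟨r_b, hr⟩ := adj (X 1 * d) r_a
      obtain ⟨f, f1, f2⟩ := homA_exists (m + 1)
        (Submodule.Quotient.mk a : Rxy ⧸ idA (m + 1)) (Submodule.Quotient.mk d) (by
          rw [← Submodule.Quotient.mk_smul, ← Submodule.Quotient.mk_smul, Submodule.Quotient.eq]
          simp only [smul_eq_mul]
          exact sub_mem (Ideal.mul_mem_right _ _ (y_memA _)) (Ideal.mul_mem_right _ _ (xk_memA _)))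
      obtain ⟨h, h1, h2⟩ := homA_exists (m + 1 + 1)
        (Submodule.Quotient.mk cc : Rxy ⧸ idA (m + 1 + 1)) (Submodule.Quotient.mk d) (by
          rw [← Submodule.Quotient.mk_smul, ← Submodule.Quotient.mk_smul, Submodule.Quotient.eq]
          simp only [smul_eq_mul]
          exact sub_mem (Ideal.mul_mem_right _ _ (y_memA _)) (Ideal.mul_mem_right _ _ (xk_memA _)))
      obtain ⟨g, g1, g2, g3⟩ := homB_exists (m + 1)
        (Submodule.Quotient.mk (cc + C p_b * X 1) : Rxy ⧸ idB (m + 1 + 1))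
        (Submodule.Quotient.mk (X 0 * d + C q_b * X 1))
        (Submodule.Quotient.mk (X 1 * d + C r_b * X 1)) (by
          rw [← Submodule.Quotient.mk_smul, ← Submodule.Quotient.mk_smul, Submodule.Quotient.eq]
          simp only [smul_eq_mul]
          have e : X 1 * (cc + C p_b * X 1) - X 0 ^ (m + 1) * (X 0 * d + C q_b * X 1) =
              (a + C c0 * X 0 ^ m - C q_b * X 0 ^ m) * (X 0 * X 1) + C p_b * X 1 ^ 2
                - d * X 0 ^ (m + 1 + 1) := by rw [hcc]; ring
          rw [e]
          exact sub_mem (add_mem (Ideal.mul_mem_left _ _ (xy_memB _))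
            (Ideal.mul_mem_left _ _ (yy_memB _))) (Ideal.mul_mem_left _ _ (xk_memB _))) (by
          rw [← Submodule.Quotient.mk_smul, ← Submodule.Quotient.mk_smul, Submodule.Quotient.eq]
          simp only [smul_eq_mul]
          have e : X 1 * (X 0 * d + C q_b * X 1) - X 0 * (X 1 * d + C r_b * X 1) =
              C q_b * X 1 ^ 2 - C r_b * (X 0 * X 1) := by ring
          rw [e]
          exact sub_mem (Ideal.mul_mem_left _ _ (yy_memB _)) (Ideal.mul_mem_left _ _ (xy_memB _)))
      have ht : (f, h, g) ∈ T := by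
        refine (mem_flag _ _ _ _ _ _).2 ⟨homA_ext ?_ ?_, homB_ext ?_ ?_ ?_⟩
        · simp only [LinearMap.comp_apply]
          have e : Submodule.inclusion (le21 (m + 1)) ⟨_, xk_memA _⟩ =
              (X 0 : Rxy) • (⟨_, xk_memA _⟩ : idA (m + 1)) := by
            ext1
            simp [pow_succ, mul_comm]
          rw [e, map_smul, f1, h1, quotFactor_mk, ← Submodule.Quotient.mk_smul,
            Submodule.Quotient.eq]
          have e_a : (X 0 : Rxy) • a - cc = (- C c0) * X 0 ^ (m + 1) := by
            rw [hcc, smul_eq_mul]; ring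
          rw [e_a]
          exact Ideal.mul_mem_left _ _ (xk_memA _)
        · simp only [LinearMap.comp_apply]
          rw [h2, quotFactor_mk]
          exact f2
        · simp only [LinearMap.comp_apply]
          rw [g1, quotFactor_mk]
          refine h1.trans ?_
          rw [Submodule.Quotient.eq]
          have e_a : cc - (cc + C p_b * X 1) = (- C p_b) * X 1 := by ring
          rw [e_a]
          exact Ideal.mul_mem_left _ _ (y_memA _)
        · simp only [LinearMap.comp_apply]
          have e : Submodule.inclusion (le32 (m + 1)) ⟨_, xy_memB _⟩ =
              (X 0 : Rxy) • (⟨_, y_memA _⟩ : idA (m + 1 + 1)) := by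
            ext1
            simp
          rw [e, map_smul, g2, h2, quotFactor_mk, ← Submodule.Quotient.mk_smul,
            Submodule.Quotient.eq]
          have e_a : (X 0 : Rxy) • d - (X 0 * d + C q_b * X 1) = (- C q_b) * X 1 := by
            rw [smul_eq_mul]; ring
          rw [e_a]
          exact Ideal.mul_mem_left _ _ (y_memA _)
        · simp only [LinearMap.comp_apply]
          have e : Submodule.inclusion (le32 (m + 1)) ⟨_, yy_memB _⟩ =
              (X 1 : Rxy) • (⟨_, y_memA _⟩ : idA (m + 1 + 1)) := by
            ext1
            simp [pow_two]
          rw [e, map_smul, g3, h2, quotFactor_mk, ← Submodule.Quotient.mk_smul,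
            Submodule.Quotient.eq]
          have e_a : (X 1 : Rxy) • d - (X 1 * d + C r_b * X 1) = (- C r_b) * X 1 := by
            rw [smul_eq_mul]; ring
          rw [e_a]
          exact Ideal.mul_mem_left _ _ (y_memA _)
      refine ⟨⟨(f, h, g), ht⟩, ?_⟩
      simp only [Φ, LinearMap.coe_mk, AddHom.coe_mk]
      rw [f1, h1, h2, g1, g2, g3, hγ, hβ, hβ, hβ]
      simp only [lcoeff_apply]
      rw [hp, hq, hr]
      have : coeff (Finsupp.single 0 (m + 1)) cc = c := by
        simp only [cc, coeff_add, coeff_monomial, if_true, c0]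
        ring
      rw [this]
  rw [(LinearEquiv.ofBijective Φ hΦ).rank_eq]
  simp only [rank_prod', rank_idA, Module.rank_self]
  norm_cast
  ring

/-- For every `n ≥ 1` there is a flag of monomial ideals of colengths `n, n+1, n+2`
whose tangent space has dimension `2n+5`. -/
theorem statement3 (n : ℕ) (hn : 1 ≤ n) :
    ∃ (I₁ I₂ I₃ : Ideal Rxy) (h21 : I₂ ≤ I₁) (h32 : I₃ ≤ I₂),
      IsMonomialIdeal I₁ ∧ IsMonomialIdeal I₂ ∧ IsMonomialIdeal I₃ ∧
      Module.rank ℂ (Rxy ⧸ I₁) = (n : Cardinal) ∧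
      Module.rank ℂ (Rxy ⧸ I₂) = ((n + 1 : ℕ) : Cardinal) ∧
      Module.rank ℂ (Rxy ⧸ I₃) = ((n + 2 : ℕ) : Cardinal) ∧
      Module.rank ℂ ↥(flagTangent3 I₁ I₂ I₃ h21 h32) = ((2 * n + 5 : ℕ) : Cardinal) := by
  obtain ⟨m, rfl⟩ : ∃ m, n = m + 1 := ⟨n - 1, by omega⟩
  exact ⟨idA (m + 1), idA (m + 1 + 1), idB (m + 1 + 1), le21 _, le32 _,
    ⟨_, idA_eq _⟩, ⟨_, idA_eq _⟩, ⟨_, idB_eq _⟩, rank_idA _, rank_idA _,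
    rank_idB _ (by omega), rank_flag m⟩
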